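/- The homomorphism φ restricts to a bijection from the ideal I = (x, y) of A = k[x,y]/(xy) onto the subset x·k[x] × y·k[y] of B = k[x] × k[y], and this subset is an ideal of B; in particular, the image φ(I) of the ideal I of A is an ideal of the larger ring B. -/

import Mathlib

open MvPolynomial

/-- The ideal (xy) in k[x,y]. -/
noncomputable def xyIdeal (k : Type*) [CommRing k] : Ideal (MvPolynomial (Fin 2) k) :=
  Ideal.span {X 0 * X 1}

/-- The coordinate ring A = k[x,y]/(xy) of the coordinate axes in the plane. -/
abbrev Axes (k : Type*) [CommRing k] := MvPolynomial (Fin 2) k ⧸ xyIdeal k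

/-- The image of x in A. -/
noncomputable def ax (k : Type*) [CommRing k] : Axes k := Ideal.Quotient.mk (xyIdeal k) (X 0)

/-- The image of y in A. -/
noncomputable def ay (k : Type*) [CommRing k] : Axes k := Ideal.Quotient.mk (xyIdeal k) (X 1)

theorem axy (k : Type*) [CommRing k] : ax k * ay k = 0 := by
  unfold ax ay
  rw [← map_mul, Ideal.Quotient.eq_zero_iff_mem]
  exact Ideal.subset_span rfl

theorem ax_mul (k : Type*) [CommRing k] (f : Axes k) :
    ∃ p : Polynomial k, ax k * f = ax k * Polynomial.aeval (ax k) p := by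
  obtain ⟨F, rfl⟩ := Ideal.Quotient.mk_surjective f
  induction F using MvPolynomial.induction_on with
  | C a => exact ⟨Polynomial.C a, by rw [Polynomial.aeval_C]; rfl⟩
  | add p q hp hq =>
    obtain ⟨p', hp⟩ := hp
    obtain ⟨q', hq⟩ := hq
    exact ⟨p' + q', by rw [map_add, map_add, mul_add, mul_add, hp, hq]⟩
  | mul_X p i hp =>
    obtain ⟨p', hp⟩ := hp
    fin_cases i
    · refine ⟨p' * Polynomial.X, ?_⟩
      rw [map_mul, map_mul, ← mul_assoc, hp, Polynomial.aeval_X, mul_assoc]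
      rfl
    · refine ⟨0, ?_⟩
      rw [map_mul, map_zero, mul_zero, mul_left_comm]
      exact (congrArg _ (axy k)).trans (mul_zero _)

theorem ay_mul (k : Type*) [CommRing k] (f : Axes k) :
    ∃ p : Polynomial k, ay k * f = ay k * Polynomial.aeval (ay k) p := by
  obtain ⟨F, rfl⟩ := Ideal.Quotient.mk_surjective f
  induction F using MvPolynomial.induction_on with
  | C a => exact ⟨Polynomial.C a, by rw [Polynomial.aeval_C]; rfl⟩
  | add p q hp hq =>
    obtain ⟨p', hp⟩ := hp
    obtain ⟨q', hq⟩ := hq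
    exact ⟨p' + q', by rw [map_add, map_add, mul_add, mul_add, hp, hq]⟩
  | mul_X p i hp =>
    obtain ⟨p', hp⟩ := hp
    fin_cases i
    · refine ⟨0, ?_⟩
      rw [map_mul, map_zero, mul_zero, mul_left_comm]
      exact (congrArg _ ((mul_comm _ _).trans (axy k))).trans (mul_zero _)
    · refine ⟨p' * Polynomial.X, ?_⟩
      rw [map_mul, map_mul, ← mul_assoc, hp, Polynomial.aeval_X, mul_assoc]
      rfl

theorem mem_form (k : Type*) [CommRing k] (f : Axes k) (hf : f ∈ Ideal.span {ax k, ay k}) :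
    ∃ p q : Polynomial k,
      f = ax k * Polynomial.aeval (ax k) p + ay k * Polynomial.aeval (ay k) q := by
  obtain ⟨a, b, rfl⟩ := Ideal.mem_span_pair.1 hf
  obtain ⟨p, hp⟩ := ax_mul k a
  obtain ⟨q, hq⟩ := ay_mul k b
  exact ⟨p, q, by rw [← hp, ← hq, mul_comm a, mul_comm b]⟩

theorem phi_form (k : Type*) [CommRing k]
    (φ : Axes k →ₐ[k] Polynomial k × Polynomial k)
    (hx : φ (ax k) = (Polynomial.X, 0)) (hy : φ (ay k) = (0, Polynomial.X))
    (p q : Polynomial k) :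
    φ (ax k * Polynomial.aeval (ax k) p + ay k * Polynomial.aeval (ay k) q)
      = (Polynomial.X * p, Polynomial.X * q) := by
  have h1 : (Polynomial.aeval (φ (ax k)) p).1 = p := by
    have := Polynomial.aeval_algHom_apply (AlgHom.fst k (Polynomial k) (Polynomial k)) (φ (ax k)) p
    rw [hx] at this ⊢
    simpa using this.symm
  have h2 : (Polynomial.aeval (φ (ay k)) q).2 = q := by
    have := Polynomial.aeval_algHom_apply (AlgHom.snd k (Polynomial k) (Polynomial k)) (φ (ay k)) q
    rw [hy] at this ⊢
    simpa using this.symm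
  rw [map_add, map_mul, map_mul, ← Polynomial.aeval_algHom_apply, ← Polynomial.aeval_algHom_apply]
  ext1
  · rw [Prod.fst_add, Prod.fst_mul, Prod.fst_mul, h1, hx, hy]; simp
  · rw [Prod.snd_add, Prod.snd_mul, Prod.snd_mul, h2, hx, hy]; simp

/-- φ restricts to a bijection from the ideal I = (x,y) of A onto the subset
x·k[x] × y·k[y] of B = k[x] × k[y], and this subset is an ideal of B; in particular the
image φ(I) is an ideal of B. -/
theorem stmt3 (k : Type*) [CommRing k]
    (φ : Axes k →ₐ[k] Polynomial k × Polynomial k)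
    (hx : φ (ax k) = (Polynomial.X, 0)) (hy : φ (ay k) = (0, Polynomial.X)) :
    Set.BijOn φ (Ideal.span {ax k, ay k} : Ideal (Axes k))
      {p : Polynomial k × Polynomial k | Polynomial.X ∣ p.1 ∧ Polynomial.X ∣ p.2} ∧
    (∃ J : Ideal (Polynomial k × Polynomial k),
      (J : Set (Polynomial k × Polynomial k)) =
        {p : Polynomial k × Polynomial k | Polynomial.X ∣ p.1 ∧ Polynomial.X ∣ p.2}) ∧
    (∃ J' : Ideal (Polynomial k × Polynomial k),
      (J' : Set (Polynomial k × Polynomial k)) =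
        φ '' (Ideal.span {ax k, ay k} : Ideal (Axes k))) := by
  have hB : Set.BijOn φ (Ideal.span {ax k, ay k} : Ideal (Axes k))
      {p : Polynomial k × Polynomial k | Polynomial.X ∣ p.1 ∧ Polynomial.X ∣ p.2} := by
    refine ⟨?_, ?_, ?_⟩
    · intro f hf
      obtain ⟨p, q, rfl⟩ := mem_form k f hf
      rw [phi_form k φ hx hy]
      exact ⟨⟨p, rfl⟩, ⟨q, rfl⟩⟩
    · intro f hf g hg h
      obtain ⟨p, q, rfl⟩ := mem_form k f hf
      obtain ⟨p', q', rfl⟩ := mem_form k g hg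
      rw [phi_form k φ hx hy, phi_form k φ hx hy, Prod.mk.injEq] at h
      rw [Polynomial.isRegular_X.left h.1, Polynomial.isRegular_X.left h.2]
    · rintro ⟨a, b⟩ ⟨⟨p, hp⟩, ⟨q, hq⟩⟩
      refine ⟨_, ?_, (phi_form k φ hx hy p q).trans (Prod.ext hp.symm hq.symm)⟩
      exact Ideal.mem_span_pair.2 ⟨Polynomial.aeval (ax k) p, Polynomial.aeval (ay k) q, by
        rw [mul_comm, mul_comm (Polynomial.aeval (ay k) q)]⟩
  have hJ : ∃ J : Ideal (Polynomial k × Polynomial k),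
      (J : Set (Polynomial k × Polynomial k)) =
        {p : Polynomial k × Polynomial k | Polynomial.X ∣ p.1 ∧ Polynomial.X ∣ p.2} := by
    refine ⟨Ideal.prod (Ideal.span {Polynomial.X}) (Ideal.span {Polynomial.X}), ?_⟩
    ext p
    simp [Ideal.mem_prod, Ideal.mem_span_singleton]
  refine ⟨hB, hJ, ?_⟩
  rw [hB.image_eq]
  exact hJ
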